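/- arXiv:2103.12880 — 5 statements merged into one kernel-verified Lean document; each statement's English description precedes it below -/
import Mathlib

section
/- Let p be a prime, let U ⊆ ℤ_p be a clopen set that is nonempty and not equal to all of ℤ_p, and let a be a positive natural number. If U + (a : ℤ_p) = U (i.e., the a-th iterate of the p-adic odometer maps U onto itself), then p divides a. -/
/-- A closed subset of `ℤ_p` mapped into itself by translation by `a` is mapped into itself by
translation by every `p`-adic integer multiple of `a`. -/
theorem PadicInt.add_mul_mem_of_isClosed {p : ℕ} [Fact p.Prime] {U : Set ℤ_[p]}
    (hU : IsClosed U) {a : ℤ_[p]} (h : ∀ x ∈ U, x + a ∈ U) {x : ℤ_[p]} (hx : x ∈ U)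
    (z : ℤ_[p]) : x + z * a ∈ U := by
  refine PadicInt.denseRange_natCast.induction_on (p := fun z => x + z * a ∈ U) z
    (hU.preimage (by fun_prop)) fun n => ?_
  induction n with
  | zero => simpa using hx
  | succ n ih =>
    have := h _ ih
    rwa [add_assoc, ← add_one_mul, ← Nat.cast_succ] at this

/-- If a nontrivial clopen subset `U` of `ℤ_p` satisfies `U + a = U` for a positive
natural number `a`, then `p` divides `a`. -/
theorem prime_dvd_of_clopen_add_image_eq_self (p : ℕ) [Fact p.Prime] (U : Set ℤ_[p])
    (hU : IsClopen U) (hne : U.Nonempty) (hnuniv : U ≠ Set.univ)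
    (a : ℕ) (ha : 0 < a) (hfix : (fun x => x + (a : ℤ_[p])) '' U = U) :
    p ∣ a := by
  by_contra hpa
  have hunit : IsUnit (a : ℤ_[p]) := by
    by_contra hn
    rw [PadicInt.not_isUnit_iff] at hn
    have hn' : ‖((a : ℤ) : ℤ_[p])‖ < 1 := by simpa using hn
    exact hpa (Int.natCast_dvd_natCast.mp ((PadicInt.norm_int_lt_one_iff_dvd _).mp hn'))
  obtain ⟨b, hb⟩ := hunit.exists_left_inv
  obtain ⟨x, hx⟩ := hne
  refine hnuniv (Set.eq_univ_of_forall fun y => ?_)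
  have h := PadicInt.add_mul_mem_of_isClosed hU.isClosed
    (fun x hx => hfix ▸ Set.mem_image_of_mem _ hx) hx ((y - x) * b)
  rwa [mul_assoc, hb, mul_one, add_sub_cancel] at h
end

section
/- Let p be a prime and let m ≥ 1. Suppose U : Fin m → Set ℤ_p is a family of pairwise disjoint nonempty clopen sets whose union is ℤ_p, and such that (U i) + 1 = U (i + 1) for all i (indices taken mod m). Then m is a power of p, i.e., there exists k : ℕ with m = p^k. -/
/-- A cyclic clopen partition of size `m` of a dynamical system `(X, σ)`: a family
`U : Fin m → Set X` of pairwise disjoint nonempty clopen sets whose union is `X`,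
with `σ '' (U i) = U (i + 1)` for all `i` (indices taken mod `m`, via `finRotate`). -/
def IsCyclicClopenPartition {X : Type*} [TopologicalSpace X] (σ : X → X)
    {m : ℕ} (U : Fin m → Set X) : Prop :=
  (∀ i, IsClopen (U i)) ∧ (∀ i, (U i).Nonempty) ∧
    Pairwise (Function.onFun Disjoint U) ∧ (⋃ i, U i) = Set.univ ∧
    ∀ i, σ '' U i = U (finRotate m i)

open Fin.CommRing in
/-- Applying `σ` `k` times to a point of the `i`-th piece leads to the piece of index `i + k`. -/
theorem IsCyclicClopenPartition.iterate_mem {X : Type*} [TopologicalSpace X] {σ : X → X} {n : ℕ}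
    {U : Fin (n + 1) → Set X} (hU : IsCyclicClopenPartition σ U) {i : Fin (n + 1)} {x : X}
    (hx : x ∈ U i) (k : ℕ) : σ^[k] x ∈ U (i + (k : Fin (n + 1))) := by
  induction k with
  | zero => simpa using hx
  | succ k ih =>
    rw [Function.iterate_succ_apply', Nat.cast_succ, ← add_assoc, ← finRotate_apply,
      ← hU.2.2.2.2]
    exact Set.mem_image_of_mem σ ih

open Fin.CommRing in
/-- If an iterate `σ^[k]` sends some point of a piece back into that piece, then the number of
pieces divides `k`. -/
theorem IsCyclicClopenPartition.dvd_of_iterate_mem {X : Type*} [TopologicalSpace X] {σ : X → X}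
    {m : ℕ} {U : Fin m → Set X} (hU : IsCyclicClopenPartition σ U) {i : Fin m} {x : X}
    (hx : x ∈ U i) {k : ℕ} (hk : σ^[k] x ∈ U i) : m ∣ k := by
  cases m with
  | zero => exact i.elim0
  | succ n =>
    have h : i = i + (k : Fin (n + 1)) := by
      by_contra hne
      exact Set.disjoint_left.mp (hU.2.2.1 hne) hk (hU.iterate_mem hx k)
    exact (Fin.natCast_eq_zero).mp (left_eq_add.mp h)

/-- If the `p`-adic odometer admits a cyclic clopen partition of size `m ≥ 1`,
then `m` is a power of `p`. -/
theorem cyclicClopenPartition_padic_size_pow (p : ℕ) [Fact p.Prime] (m : ℕ) (hm : 1 ≤ m)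
    (U : Fin m → Set ℤ_[p]) (hU : IsCyclicClopenPartition (fun x => x + 1) U) :
    ∃ k : ℕ, m = p ^ k := by
  obtain ⟨x, hx⟩ := hU.2.1 ⟨0, hm⟩
  have hp : Filter.Tendsto (fun n : ℕ => x + (p : ℤ_[p]) ^ n) Filter.atTop (nhds x) := by
    simpa using (tendsto_pow_atTop_nhds_zero_of_norm_lt_one
      (PadicInt.norm_lt_one_iff_dvd (p : ℤ_[p]) |>.mpr dvd_rfl)).const_add x
  obtain ⟨n, hn⟩ := (hp.eventually_mem ((hU.1 ⟨0, hm⟩).isOpen.mem_nhds hx)).exists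
  have hdvd : m ∣ p ^ n := hU.dvd_of_iterate_mem hx (by simpa using hn)
  obtain ⟨k, -, hk⟩ := (Nat.dvd_prime_pow Fact.out).mp hdvd
  exact ⟨k, hk⟩
end

section
/- Let a, b : ℕ → ℕ be sequences with a n ≥ 2 and b n ≥ 2 for all n, and let σ_a : X_a → X_a and σ_b : X_b → X_b be homeomorphisms that are the odometer maps for a and b respectively. Then there exists a homeomorphism h : X_a → X_b with h ∘ σ_a = σ_b ∘ h if and only if both: (i) for every N there exists M such that ∏_{i<N} a i divides ∏_{i<M} b i, and (ii) for every K there exists L such that ∏_{i<K} b i divides ∏_{i<L} a i. -/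
/-- `σ` is the odometer map (addition by one with carry) for the sequence `a`:
the all-max point is sent to the all-zeros point, and any other point `x`, with
least index `n₀` such that `x n₀ < a n₀ - 1`, is sent to the point which is `0`
below `n₀`, is `x n₀ + 1` at `n₀`, and agrees with `x` above `n₀`. -/
def IsOdometerMap (a : ℕ → ℕ) (σ : (∀ n, Fin (a n)) → ∀ n, Fin (a n)) : Prop :=
  ∀ x : ∀ n, Fin (a n),
    ((∀ n, (x n : ℕ) = a n - 1) → ∀ i, (σ x i : ℕ) = 0) ∧
    (∀ n₀ : ℕ, (x n₀ : ℕ) < a n₀ - 1 → (∀ i < n₀, (x i : ℕ) = a i - 1) →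
      (∀ i < n₀, (σ x i : ℕ) = 0) ∧ ((σ x n₀ : ℕ) = (x n₀ : ℕ) + 1) ∧
        ∀ i, n₀ < i → σ x i = x i)

namespace Odometer

open Finset Filter Topology

/-- The integer with mixed-radix digits `x 0, …, x (n - 1)` in the bases `a 0, …, a (n - 1)`. -/
def partialValue (a : ℕ → ℕ) (n : ℕ) (x : ∀ n, Fin (a n)) : ℕ :=
  ∑ i ∈ range n, (x i : ℕ) * ∏ j ∈ range i, a j

variable {a b : ℕ → ℕ}

lemma partialValue_succ (n : ℕ) (x : ∀ n, Fin (a n)) :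
    partialValue a (n + 1) x = partialValue a n x + (x n : ℕ) * ∏ j ∈ range n, a j :=
  sum_range_succ _ _

lemma partialValue_lt (n : ℕ) (x : ∀ n, Fin (a n)) :
    partialValue a n x < ∏ j ∈ range n, a j := by
  induction n with
  | zero => simp [partialValue]
  | succ n ih =>
    rw [partialValue_succ, prod_range_succ]
    have h : ((x n : ℕ) + 1) * ∏ j ∈ range n, a j ≤ a n * ∏ j ∈ range n, a j :=
      Nat.mul_le_mul_right _ (x n).isLt
    linarith

lemma prod_pos_of_point (x : ∀ n, Fin (a n)) (n : ℕ) : 0 < ∏ j ∈ range n, a j :=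
  (Nat.zero_le _).trans_lt (partialValue_lt n x)

lemma partialValue_mod (n : ℕ) (x : ∀ n, Fin (a n)) :
    partialValue a n x % ∏ j ∈ range n, a j = partialValue a n x :=
  Nat.mod_eq_of_lt (partialValue_lt n x)

lemma partialValue_modEq {m n : ℕ} (h : n ≤ m) (x : ∀ n, Fin (a n)) :
    partialValue a m x ≡ partialValue a n x [MOD ∏ j ∈ range n, a j] := by
  induction m, h using Nat.le_induction with
  | base => rfl
  | succ m hm ih =>
    rw [partialValue_succ]
    have hd : ∏ j ∈ range n, a j ∣ (x m : ℕ) * ∏ j ∈ range m, a j :=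
      (prod_dvd_prod_of_subset _ _ _ (range_mono hm)).mul_left _
    simpa using ih.add ((Nat.modEq_zero_iff_dvd).2 hd)

lemma partialValue_modEq_of_dvd {d m n : ℕ} (hm : d ∣ ∏ j ∈ range m, a j)
    (hn : d ∣ ∏ j ∈ range n, a j) (x : ∀ n, Fin (a n)) :
    partialValue a m x ≡ partialValue a n x [MOD d] := by
  rcases le_total n m with h | h
  · exact (partialValue_modEq h x).of_dvd hn
  · exact ((partialValue_modEq h x).of_dvd hm).symm

lemma val_eq_partialValue_div (n : ℕ) (x : ∀ n, Fin (a n)) :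
    (x n : ℕ) = partialValue a (n + 1) x / ∏ j ∈ range n, a j := by
  rw [partialValue_succ, Nat.add_mul_div_right _ _ (prod_pos_of_point x n),
    Nat.div_eq_of_lt (partialValue_lt n x), zero_add]

lemma ext_of_partialValue {x y : ∀ n, Fin (a n)}
    (h : ∀ n, partialValue a n x ≡ partialValue a n y [MOD ∏ j ∈ range n, a j]) : x = y := by
  ext n
  have hn := h (n + 1)
  rw [Nat.ModEq, partialValue_mod, partialValue_mod] at hn
  rw [val_eq_partialValue_div n x, val_eq_partialValue_div n y, hn]

lemma continuous_partialValue (n : ℕ) : Continuous (partialValue a n) := by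
  refine continuous_finsetSum _ fun i _ => Continuous.mul ?_ continuous_const
  exact continuous_of_discreteTopology.comp (continuous_apply i)

lemma _root_.IsOdometerMap.digit {σ : (∀ n, Fin (a n)) → ∀ n, Fin (a n)} (hσ : IsOdometerMap a σ)
    (x : ∀ n, Fin (a n)) (n : ℕ) :
    (σ x n : ℕ) = if ∀ i < n, (x i : ℕ) = a i - 1 then
      (if (x n : ℕ) = a n - 1 then 0 else (x n : ℕ) + 1) else x n := by
  have hle : ∀ i, (x i : ℕ) ≤ a i - 1 := fun i => Nat.le_sub_one_of_lt (x i).isLt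
  by_cases hmax : ∀ i, (x i : ℕ) = a i - 1
  · simp [(hσ x).1 hmax n, hmax]
  · push Not at hmax
    classical
    set k := Nat.find hmax
    have hk1 : (x k : ℕ) ≠ a k - 1 := Nat.find_spec hmax
    have hk2 : ∀ i < k, (x i : ℕ) = a i - 1 := fun i hi => not_not.1 (Nat.find_min hmax hi)
    obtain ⟨h0, h1, h2⟩ := (hσ x).2 k (lt_of_le_of_ne (hle k) hk1) hk2
    rcases lt_trichotomy n k with h | h | h
    · rw [if_pos fun i hi => hk2 i (hi.trans h), if_pos (hk2 n h), h0 n h]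
    · rw [h, if_pos hk2, if_neg hk1, h1]
    · rw [if_neg fun H => hk1 (H k h), h2 n h]

lemma _root_.IsOdometerMap.partialValue_add {σ : (∀ n, Fin (a n)) → ∀ n, Fin (a n)}
    (hσ : IsOdometerMap a σ) (x : ∀ n, Fin (a n)) (n : ℕ) :
    partialValue a n (σ x) +
        (if ∀ i < n, (x i : ℕ) = a i - 1 then ∏ j ∈ range n, a j else 0) =
      partialValue a n x + 1 := by
  induction n with
  | zero => simp [partialValue]
  | succ n ih =>
    rw [partialValue_succ, partialValue_succ, hσ.digit x n, prod_range_succ]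
    simp only [Nat.lt_succ_iff_lt_or_eq, or_imp, forall_and, forall_eq]
    have hpos : 0 < a n := (x n).pos
    by_cases h : ∀ i < n, (x i : ℕ) = a i - 1
    · simp only [if_pos h] at ih ⊢
      by_cases hn : (x n : ℕ) = a n - 1
      · obtain ⟨c, hc⟩ := Nat.exists_eq_add_of_lt hpos
        rw [if_pos hn, if_pos ⟨h, hn⟩, hn, hc]
        simp only [zero_add, Nat.add_sub_cancel, zero_mul, add_zero]
        linarith
      · simp only [hn, and_false, if_false]
        linarith
    · simp only [h, false_and, if_false] at ih ⊢
      linarith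

lemma _root_.IsOdometerMap.partialValue_modEq {σ : (∀ n, Fin (a n)) → ∀ n, Fin (a n)}
    (hσ : IsOdometerMap a σ) (x : ∀ n, Fin (a n)) (n : ℕ) :
    partialValue a n (σ x) ≡ partialValue a n x + 1 [MOD ∏ j ∈ range n, a j] := by
  rw [← hσ.partialValue_add x n]
  split_ifs <;> simp [Nat.ModEq]

lemma _root_.IsOdometerMap.partialValue_iterate_modEq {σ : (∀ n, Fin (a n)) → ∀ n, Fin (a n)}
    (hσ : IsOdometerMap a σ) (x : ∀ n, Fin (a n)) (n k : ℕ) :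
    partialValue a n (σ^[k] x) ≡ partialValue a n x + k [MOD ∏ j ∈ range n, a j] := by
  induction k with
  | zero => rfl
  | succ k ih =>
    rw [Function.iterate_succ_apply']
    exact (hσ.partialValue_modEq _ n).trans (ih.add_right 1)

lemma _root_.IsOdometerMap.tendsto_iterate {σ : (∀ n, Fin (a n)) → ∀ n, Fin (a n)}
    (hσ : IsOdometerMap a σ) (x : ∀ n, Fin (a n)) :
    Tendsto (fun m => σ^[∏ j ∈ range m, a j] x) atTop (𝓝 x) := by
  refine tendsto_pi_nhds.2 fun i => tendsto_const_nhds.congr' ?_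
  filter_upwards [eventually_ge_atTop (i + 1)] with m hm
  have hd : ∏ j ∈ range (i + 1), a j ∣ ∏ j ∈ range m, a j :=
    prod_dvd_prod_of_subset _ _ _ (range_mono hm)
  have h := (hσ.partialValue_iterate_modEq x (i + 1) (∏ j ∈ range m, a j)).trans
    ((Nat.modEq_zero_iff_dvd.2 hd).add_left _)
  rw [add_zero, Nat.ModEq, partialValue_mod, partialValue_mod] at h
  ext
  rw [val_eq_partialValue_div i x, val_eq_partialValue_div i (σ^[_] x), h]

/-- A continuous semiconjugacy between odometers forces divisibility of partial products. -/
lemma exists_prod_dvd_of_semiconj {σa : (∀ n, Fin (a n)) → ∀ n, Fin (a n)}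
    {σb : (∀ n, Fin (b n)) → ∀ n, Fin (b n)} (hσa : IsOdometerMap a σa)
    (hσb : IsOdometerMap b σb) {h : (∀ n, Fin (a n)) → ∀ n, Fin (b n)} (hc : Continuous h)
    (hs : Function.Semiconj h σa σb) (x : ∀ n, Fin (a n)) (K : ℕ) :
    ∃ L, ∏ i ∈ range K, b i ∣ ∏ i ∈ range L, a i := by
  have ht := (((continuous_partialValue K).comp hc).tendsto x).comp (hσa.tendsto_iterate x)
  rw [nhds_discrete, tendsto_pure] at ht
  obtain ⟨L, hL⟩ := ht.exists
  refine ⟨L, ?_⟩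
  simp only [Function.comp_apply, (hs.iterate_right _).eq] at hL
  have h := hσb.partialValue_iterate_modEq (h x) K (∏ i ∈ range L, a i)
  rw [hL] at h
  exact Nat.modEq_zero_iff_dvd.1 (Nat.ModEq.add_left_cancel' _ h.symm)

/-- Divisibility of partial products produces a continuous map reducing partial values. -/
lemma exists_continuous_partialValue_modEq (hb : ∀ n, 0 < b n)
    (hdvd : ∀ K, ∃ L, ∏ i ∈ range K, b i ∣ ∏ i ∈ range L, a i) :
    ∃ g : (∀ n, Fin (a n)) → ∀ n, Fin (b n), Continuous g ∧
      ∀ x K L, ∏ i ∈ range K, b i ∣ ∏ i ∈ range L, a i →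
        partialValue b K (g x) ≡ partialValue a L x [MOD ∏ i ∈ range K, b i] := by
  choose L hL using hdvd
  let F (i v : ℕ) : Fin (b i) :=
    ⟨v % (∏ j ∈ range (i + 1), b j) / ∏ j ∈ range i, b j, by
      refine Nat.div_lt_of_lt_mul ?_
      rw [← prod_range_succ]
      exact Nat.mod_lt _ (prod_pos fun j _ => hb j)⟩
  refine ⟨fun x i => F i (partialValue a (L (i + 1)) x), continuous_pi fun i =>
    (continuous_of_discreteTopology (f := F i)).comp (continuous_partialValue _), fun x K => ?_⟩
  suffices H : partialValue b K (fun i => F i (partialValue a (L (i + 1)) x)) =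
      partialValue a (L K) x % ∏ i ∈ range K, b i by
    intro M hM
    rw [H]
    exact (Nat.mod_modEq _ _).trans (partialValue_modEq_of_dvd (hL K) hM x)
  induction K with
  | zero => simp [partialValue, Nat.mod_one]
  | succ K ih =>
    have hd : ∏ j ∈ range K, b j ∣ ∏ j ∈ range (K + 1), b j :=
      prod_dvd_prod_of_subset _ _ _ (range_mono K.le_succ)
    have hmod : partialValue a (L K) x % ∏ i ∈ range K, b i =
        partialValue a (L (K + 1)) x % (∏ i ∈ range (K + 1), b i) % ∏ i ∈ range K, b i := by
      rw [Nat.mod_mod_of_dvd _ hd]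
      exact partialValue_modEq_of_dvd (hL K) (hd.trans (hL (K + 1))) x
    rw [partialValue_succ, ih, hmod]
    exact Nat.mod_add_div' _ _

lemma leftInverse_of_partialValue_modEq
    (ha : ∀ N, ∃ M, ∏ i ∈ range N, a i ∣ ∏ i ∈ range M, b i)
    (hb : ∀ K, ∃ L, ∏ i ∈ range K, b i ∣ ∏ i ∈ range L, a i)
    {g : (∀ n, Fin (a n)) → ∀ n, Fin (b n)} {f : (∀ n, Fin (b n)) → ∀ n, Fin (a n)}
    (hg : ∀ x K L, ∏ i ∈ range K, b i ∣ ∏ i ∈ range L, a i →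
      partialValue b K (g x) ≡ partialValue a L x [MOD ∏ i ∈ range K, b i])
    (hf : ∀ y N M, ∏ i ∈ range N, a i ∣ ∏ i ∈ range M, b i →
      partialValue a N (f y) ≡ partialValue b M y [MOD ∏ i ∈ range N, a i]) :
    Function.LeftInverse f g := by
  intro x
  refine ext_of_partialValue fun N => ?_
  obtain ⟨M, hM⟩ := ha N
  obtain ⟨L, hL⟩ := hb M
  exact ((hf _ N M hM).trans ((hg x M L hL).of_dvd hM)).trans
    (partialValue_modEq_of_dvd (hM.trans hL) dvd_rfl x)

lemma semiconj_of_partialValue_modEq {σa : (∀ n, Fin (a n)) → ∀ n, Fin (a n)}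
    {σb : (∀ n, Fin (b n)) → ∀ n, Fin (b n)} (hσa : IsOdometerMap a σa)
    (hσb : IsOdometerMap b σb)
    (hb : ∀ K, ∃ L, ∏ i ∈ range K, b i ∣ ∏ i ∈ range L, a i)
    {g : (∀ n, Fin (a n)) → ∀ n, Fin (b n)}
    (hg : ∀ x K L, ∏ i ∈ range K, b i ∣ ∏ i ∈ range L, a i →
      partialValue b K (g x) ≡ partialValue a L x [MOD ∏ i ∈ range K, b i]) :
    Function.Semiconj g σa σb := by
  intro x
  refine ext_of_partialValue fun K => ?_
  obtain ⟨L, hL⟩ := hb K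
  exact ((hg _ K L hL).trans ((hσa.partialValue_modEq x L).of_dvd hL)).trans
    ((hσb.partialValue_modEq _ K).trans ((hg x K L hL).add_right 1)).symm

end Odometer

/-- Two odometers are topologically conjugate if and only if the associated
sequences of partial products mutually divide each other in the tail. -/
theorem odometers_conjugate_iff (a b : ℕ → ℕ) (ha : ∀ n, 2 ≤ a n) (hb : ∀ n, 2 ≤ b n)
    (σa : (∀ n, Fin (a n)) ≃ₜ (∀ n, Fin (a n)))
    (σb : (∀ n, Fin (b n)) ≃ₜ (∀ n, Fin (b n)))
    (hσa : IsOdometerMap a σa) (hσb : IsOdometerMap b σb) :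
    (∃ h : (∀ n, Fin (a n)) ≃ₜ (∀ n, Fin (b n)), ∀ x, h (σa x) = σb (h x)) ↔
      ((∀ N : ℕ, ∃ M : ℕ,
          (∏ i ∈ Finset.range N, a i) ∣ ∏ i ∈ Finset.range M, b i) ∧
        (∀ K : ℕ, ∃ L : ℕ,
          (∏ i ∈ Finset.range K, b i) ∣ ∏ i ∈ Finset.range L, a i)) := by
  constructor
  · rintro ⟨h, hh⟩
    have hs : Function.Semiconj h σa σb := hh
    let x : ∀ n, Fin (a n) := fun n => ⟨0, by have := ha n; omega⟩
    refine ⟨fun N => ?_, fun K => ?_⟩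
    · exact Odometer.exists_prod_dvd_of_semiconj hσb hσa h.symm.continuous
        (hs.inverse_left h.symm_apply_apply h.apply_symm_apply) (h x) N
    · exact Odometer.exists_prod_dvd_of_semiconj hσa hσb h.continuous hs x K
  · rintro ⟨hab, hba⟩
    obtain ⟨g, hgc, hg⟩ := Odometer.exists_continuous_partialValue_modEq
      (fun n => two_pos.trans_le (hb n)) hba
    obtain ⟨f, hfc, hf⟩ := Odometer.exists_continuous_partialValue_modEq
      (fun n => two_pos.trans_le (ha n)) hab
    exact ⟨{ toFun := g
             invFun := f
             left_inv := Odometer.leftInverse_of_partialValue_modEq hab hba hg hf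
             right_inv := Odometer.leftInverse_of_partialValue_modEq hba hab hf hg
             continuous_toFun := hgc
             continuous_invFun := hfc },
      Odometer.semiconj_of_partialValue_modEq hσa hσb hba hg⟩
end

section
/- Let a, b : ℕ → ℕ be sequences with a n ≥ 2 and b n ≥ 2 for all n, and let σ_a : X_a → X_a and σ_b : X_b → X_b be homeomorphisms that are the odometer maps for a and b. Suppose that for every m ≥ 1, (X_a, σ_a) admits a cyclic clopen partition of size m if and only if (X_b, σ_b) does. Then the two odometers are topologically conjugate: there exists a homeomorphism h : X_a → X_b with h ∘ σ_a = σ_b ∘ h. -/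
open Finset in
/-- The point of `∏ n, Fin (a n)` whose coordinates are the mixed-radix digits of `k`. -/
def odometerPoint (a : ℕ → ℕ) (ha : ∀ n, 2 ≤ a n) (k : ℕ) (n : ℕ) : Fin (a n) :=
  ⟨k / (∏ i ∈ range n, a i) % a n, Nat.mod_lt _ (by have := ha n; omega)⟩

section Digits

open Finset

variable {a : ℕ → ℕ}

theorem two_pow_le_prod_range (ha : ∀ n, 2 ≤ a n) (n : ℕ) : 2 ^ n ≤ ∏ i ∈ range n, a i := by
  simpa using prod_le_prod' (s := range n) (fun i _ => ha i)

theorem prod_range_pos (ha : ∀ n, 2 ≤ a n) (n : ℕ) : 0 < ∏ i ∈ range n, a i :=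
  prod_pos fun i _ => by have := ha i; omega

theorem odometerPoint_sum (ha : ∀ n, 2 ≤ a n) (k n : ℕ) :
    ∑ j ∈ range n, (∏ i ∈ range j, a i) * (odometerPoint a ha k j : ℕ) =
      k % ∏ i ∈ range n, a i := by
  induction n with
  | zero => simp [Nat.mod_one]
  | succ n ih => rw [sum_range_succ, ih, prod_range_succ, Nat.mod_mul]; rfl

theorem succ_mod_eq_of_mod_lt {q c : ℕ} (h : q % c < c - 1) : (q + 1) % c = q % c + 1 := by
  rw [Nat.add_mod, Nat.mod_eq_of_lt (a := 1) (by omega), Nat.mod_eq_of_lt (by omega)]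

theorem dvd_succ_of_mod_eq {q c : ℕ} (hc : 0 < c) (h : q % c = c - 1) : c ∣ q + 1 := by
  refine ⟨q / c + 1, ?_⟩
  have := Nat.div_add_mod q c
  rw [mul_add]
  omega

theorem prod_range_dvd_succ (ha : ∀ n, 2 ≤ a n) {k n : ℕ}
    (h : ∀ i < n, (odometerPoint a ha k i : ℕ) = a i - 1) : ∏ i ∈ range n, a i ∣ k + 1 := by
  induction n with
  | zero => simp
  | succ n ih =>
    have hd := ih fun i hi => h i (by omega)
    have hn : k / (∏ i ∈ range n, a i) % a n = a n - 1 := h n (by omega)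
    have := dvd_succ_of_mod_eq (by have := ha n; omega) hn
    rw [prod_range_succ]
    refine Nat.mul_dvd_of_dvd_div hd ?_
    rwa [Nat.succ_div_of_dvd hd]

theorem IsOdometerMap.apply_odometerPoint {σ : (∀ n, Fin (a n)) → ∀ n, Fin (a n)}
    (hσ : IsOdometerMap a σ) (ha : ∀ n, 2 ≤ a n) (k : ℕ) :
    σ (odometerPoint a ha k) = odometerPoint a ha (k + 1) := by
  classical
  have hex : ∃ n, (odometerPoint a ha k n : ℕ) < a n - 1 := by
    refine ⟨k, ?_⟩
    have h1 : k < ∏ i ∈ range k, a i := Nat.lt_two_pow_self.trans_le (two_pow_le_prod_range ha k)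
    have := ha k
    simp only [odometerPoint, Nat.div_eq_of_lt h1, Nat.zero_mod]
    omega
  obtain ⟨n, hn, hmin⟩ : ∃ n, (odometerPoint a ha k n : ℕ) < a n - 1 ∧
      ∀ i < n, (odometerPoint a ha k i : ℕ) = a i - 1 := by
    refine ⟨Nat.find hex, Nat.find_spec hex, fun i hi => ?_⟩
    have := Nat.find_min hex hi
    have := (odometerPoint a ha k i).isLt
    omega
  obtain ⟨hlow, hmid, hhigh⟩ := (hσ _).2 n hn hmin
  have hd := prod_range_dvd_succ ha hmin
  have hn' : k / (∏ i ∈ range n, a i) % a n < a n - 1 := hn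
  have hsucc := succ_mod_eq_of_mod_lt hn'
  funext i
  apply Fin.ext
  rcases lt_trichotomy i n with hi | rfl | hi
  · rw [hlow i hi]
    have hdi : (∏ j ∈ range i, a j) * a i ∣ k + 1 := by
      rw [← prod_range_succ]
      exact prod_range_dvd_succ ha fun j hj => hmin j (by omega)
    exact (Nat.mod_eq_zero_of_dvd (Nat.dvd_div_of_mul_dvd hdi)).symm
  · rw [hmid]
    simp only [odometerPoint, Nat.succ_div_of_dvd hd, hsucc]
  · rw [hhigh i hi]
    have hnd : ¬ ∏ j ∈ range i, a j ∣ k + 1 := fun h => by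
      have h1 : (∏ j ∈ range n, a j) * a n ∣ k + 1 := by
        rw [← prod_range_succ]
        exact (prod_dvd_prod_of_subset _ _ _ (range_mono hi)).trans h
      have h2 := Nat.mod_eq_zero_of_dvd (Nat.dvd_div_of_mul_dvd h1)
      rw [Nat.succ_div_of_dvd hd, hsucc] at h2
      omega
    simp only [odometerPoint, Nat.succ_div_of_not_dvd hnd]

theorem exists_odometerPoint_eq_of_lt (ha : ∀ n, 2 ≤ a n) (x : ∀ n, Fin (a n)) (n : ℕ) :
    ∃ k, ∀ i < n, odometerPoint a ha k i = x i := by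
  induction n with
  | zero => exact ⟨0, by simp⟩
  | succ n ih =>
    obtain ⟨k, hk⟩ := ih
    refine ⟨k % (∏ i ∈ range n, a i) + (∏ i ∈ range n, a i) * x n, fun i hi => ?_⟩
    rcases Nat.lt_succ_iff_lt_or_eq.1 hi with hi | rfl
    · rw [← hk i hi]
      apply Fin.ext
      have hd : (∏ j ∈ range i, a j) * a i ∣ ∏ j ∈ range n, a j := by
        rw [← prod_range_succ]
        exact prod_dvd_prod_of_subset _ _ _ (range_mono hi)
      simp only [odometerPoint]
      rw [← Nat.mod_mul_right_div_self, ← Nat.mod_mul_right_div_self, Nat.add_mod,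
        Nat.mod_mod_of_dvd _ hd, Nat.mod_eq_zero_of_dvd (hd.mul_right _), add_zero, Nat.mod_mod]
    · apply Fin.ext
      simp only [odometerPoint]
      rw [Nat.add_mul_div_left _ _ (prod_range_pos ha i),
        Nat.div_eq_of_lt (Nat.mod_lt _ (prod_range_pos ha i)), zero_add,
        Nat.mod_eq_of_lt (x i).isLt]

theorem denseRange_odometerPoint (ha : ∀ n, 2 ≤ a n) : DenseRange (odometerPoint a ha) := by
  intro x
  choose k hk using exists_odometerPoint_eq_of_lt ha x
  refine mem_closure_of_tendsto (f := fun n => odometerPoint a ha (k n)) (b := Filter.atTop)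
    (tendsto_pi_nhds.2 fun i => ?_) (.of_forall fun n => ⟨k n, rfl⟩)
  refine tendsto_const_nhds.congr' ?_
  filter_upwards [Filter.eventually_gt_atTop i] with n hn using (hk n i hn).symm

end Digits

section Partitions

open scoped Fin.CommRing Fin.NatCast

variable {X : Type*} [TopologicalSpace X] {f : X → X} {p : ℕ → X} {m : ℕ}

/-- A cyclic clopen partition yields a continuous function counting time modulo `m` along an
orbit. -/
theorem IsCyclicClopenPartition.exists_continuous_mod [NeZero m] {U : Fin m → Set X}
    (hU : IsCyclicClopenPartition f U) (hp : ∀ k, f (p k) = p (k + 1)) :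
    ∃ g : X → ℕ, Continuous g ∧ ∀ k, g (p k) = k % m := by
  obtain ⟨m, rfl⟩ := Nat.exists_eq_succ_of_ne_zero (NeZero.ne m)
  obtain ⟨hcl, -, hdisj, hcov, hrot⟩ := hU
  have hex : ∀ x, ∃ i, x ∈ U i := fun x => Set.mem_iUnion.1 (hcov ▸ Set.mem_univ x)
  choose c hc using hex
  have huniq : ∀ {x i}, x ∈ U i → c x = i := fun {x i} hx => by
    by_contra hne
    exact Set.disjoint_left.1 (hdisj hne) (hc x) hx
  have hcont : Continuous c := continuous_discrete_rng.2 fun i => by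
    have : c ⁻¹' {i} = U i := Set.ext fun x => ⟨fun h => h ▸ hc x, huniq⟩
    exact this ▸ (hcl i).isOpen
  have hstep : ∀ x, c (f x) = c x + 1 := fun x => huniq <| by
    rw [← finRotate_apply, ← hrot]
    exact ⟨x, hc x, rfl⟩
  have horb : ∀ k : ℕ, c (p k) = c (p 0) + (k : Fin (m + 1)) := fun k => by
    induction k with
    | zero => simp
    | succ k ih => rw [← hp, hstep, ih, Nat.cast_succ, add_assoc]
  refine ⟨fun x => (c x - c (p 0) : Fin (m + 1)),
    (continuous_of_discreteTopology (f := fun i : Fin (m + 1) => ((i - c (p 0) : Fin _) : ℕ))).comp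
      hcont, fun k => ?_⟩
  change ((c (p k) - c (p 0) : Fin (m + 1)) : ℕ) = k % (m + 1)
  rw [horb, add_sub_cancel_left, Fin.val_natCast]

theorem exists_isCyclicClopenPartition_of_continuous_mod [NeZero m] (hf : Continuous f)
    (hsurj : f.Surjective) (hp : ∀ k, f (p k) = p (k + 1)) (hd : DenseRange p)
    {g : X → ℕ} (hg : Continuous g) (hgp : ∀ k, g (p k) = k % m) :
    ∃ U : Fin m → Set X, IsCyclicClopenPartition f U := by
  obtain ⟨m, rfl⟩ := Nat.exists_eq_succ_of_ne_zero (NeZero.ne m)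
  let c : X → Fin (m + 1) := fun x => (g x : Fin (m + 1))
  have hcont : Continuous c :=
    (continuous_of_discreteTopology (f := fun i : ℕ => (i : Fin (m + 1)))).comp hg
  have hcp : ∀ k : ℕ, c (p k) = k := fun k => by simp [c, hgp, Fin.ext_iff, Fin.val_natCast]
  have hstep : ∀ x, c (f x) = c x + 1 := by
    refine congrFun (hd.equalizer (hcont.comp hf)
      ((continuous_of_discreteTopology (f := fun i : Fin (m + 1) => i + 1)).comp hcont) ?_)
    funext k
    simp [hp, hcp]
  refine ⟨fun i => c ⁻¹' {i}, fun i => (isClopen_discrete {i}).preimage hcont,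
    fun i => ⟨p i, by simp [hcp]⟩, fun i j hij => ?_, by ext; simp, fun i => ?_⟩
  · exact Disjoint.preimage c (Set.disjoint_singleton.2 hij)
  · rw [finRotate_apply]
    ext y
    obtain ⟨x, rfl⟩ := hsurj y
    constructor
    · rintro ⟨z, rfl, hz⟩
      rw [← hz]
      exact hstep z
    · intro h
      exact ⟨x, add_right_cancel ((hstep x).symm.trans h), rfl⟩

end Partitions

open Finset in
theorem IsOdometerMap.exists_isCyclicClopenPartition {a : ℕ → ℕ} (ha : ∀ n, 2 ≤ a n)
    {σ : (∀ n, Fin (a n)) ≃ₜ (∀ n, Fin (a n))} (hσ : IsOdometerMap a σ) (n : ℕ) :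
    ∃ U : Fin (∏ i ∈ range n, a i) → Set (∀ n, Fin (a n)), IsCyclicClopenPartition σ U := by
  have : NeZero (∏ i ∈ range n, a i) := ⟨(prod_range_pos ha n).ne'⟩
  refine exists_isCyclicClopenPartition_of_continuous_mod σ.continuous σ.surjective
    (hσ.apply_odometerPoint ha) (denseRange_odometerPoint ha)
    (g := fun x => ∑ j ∈ range n, (∏ i ∈ range j, a i) * (x j : ℕ)) ?_
    fun k => odometerPoint_sum ha k n
  refine continuous_finsetSum _ fun j _ => ?_
  exact (continuous_of_discreteTopology
    (f := fun i : Fin (a j) => (∏ i ∈ range j, a i) * (i : ℕ))).comp (continuous_apply j)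

open Finset in
/-- A system with cyclic clopen partitions of all sizes `a 0 * ⋯ * a (n - 1)` maps continuously
to `∏ n, Fin (a n)`, sending a given orbit to the orbit of zero. -/
theorem exists_continuous_odometerPoint {a : ℕ → ℕ} (ha : ∀ n, 2 ≤ a n) {X : Type*}
    [TopologicalSpace X] {f : X → X} {p : ℕ → X} (hp : ∀ k, f (p k) = p (k + 1))
    (hpart : ∀ n, ∃ U : Fin (∏ i ∈ range n, a i) → Set X, IsCyclicClopenPartition f U) :
    ∃ h : X → ∀ n, Fin (a n), Continuous h ∧ ∀ k, h (p k) = odometerPoint a ha k := by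
  have hg : ∀ n, ∃ g : X → ℕ, Continuous g ∧ ∀ k, g (p k) = k % ∏ i ∈ range n, a i := fun n => by
    have : NeZero (∏ i ∈ range n, a i) := ⟨(prod_range_pos ha n).ne'⟩
    obtain ⟨U, hU⟩ := hpart n
    exact hU.exists_continuous_mod hp
  choose g hgc hgp using hg
  refine ⟨fun x n => odometerPoint a ha (g (n + 1) x) n, continuous_pi fun n =>
    (continuous_of_discreteTopology (f := fun k => odometerPoint a ha k n)).comp (hgc (n + 1)),
    fun k => funext fun n => Fin.ext ?_⟩
  simp only [odometerPoint, hgp, prod_range_succ, Nat.mod_mul_right_div_self, Nat.mod_mod]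

/-- If two odometers admit cyclic clopen partitions of exactly the same sizes
`m ≥ 1`, then they are topologically conjugate. -/
theorem odometers_conjugate_of_same_partitions (a b : ℕ → ℕ)
    (ha : ∀ n, 2 ≤ a n) (hb : ∀ n, 2 ≤ b n)
    (σa : (∀ n, Fin (a n)) ≃ₜ (∀ n, Fin (a n)))
    (σb : (∀ n, Fin (b n)) ≃ₜ (∀ n, Fin (b n)))
    (hσa : IsOdometerMap a σa) (hσb : IsOdometerMap b σb)
    (hpart : ∀ m : ℕ, 1 ≤ m →
      ((∃ U : Fin m → Set (∀ n, Fin (a n)), IsCyclicClopenPartition σa U) ↔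
        (∃ U : Fin m → Set (∀ n, Fin (b n)), IsCyclicClopenPartition σb U))) :
    ∃ h : (∀ n, Fin (a n)) ≃ₜ (∀ n, Fin (b n)), ∀ x, h (σa x) = σb (h x) := by
  have hpa := hσa.apply_odometerPoint ha
  have hpb := hσb.apply_odometerPoint hb
  have hda := denseRange_odometerPoint ha
  have hdb := denseRange_odometerPoint hb
  obtain ⟨h, hc, hh⟩ := exists_continuous_odometerPoint hb hpa fun n =>
    (hpart _ (prod_range_pos hb n)).2 (hσb.exists_isCyclicClopenPartition hb n)
  obtain ⟨h', hc', hh'⟩ := exists_continuous_odometerPoint ha hpb fun n =>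
    (hpart _ (prod_range_pos ha n)).1 (hσa.exists_isCyclicClopenPartition ha n)
  refine ⟨⟨⟨h, h', congrFun (hda.equalizer (hc'.comp hc) continuous_id ?_),
    congrFun (hdb.equalizer (hc.comp hc') continuous_id ?_)⟩, hc, hc'⟩,
    congrFun (hda.equalizer (hc.comp σa.continuous) (σb.continuous.comp hc) ?_)⟩ <;>
  · funext k
    simp [hh, hh', hpa, hpb]
end

section
/- (Amalgamation for finite systems with a permutation.) Let W, X, Y be finite nonempty types with permutations σ of W, τ of X, and π of Y, and let f : X → W and g : Y → W be surjections with f ∘ τ = σ ∘ f and g ∘ π = σ ∘ g. Then there exist a finite nonempty type Z, a permutation ρ of Z, and surjections h : Z → X and i : Z → Y such that h ∘ ρ = τ ∘ h, i ∘ ρ = π ∘ i, and f ∘ h = g ∘ i. -/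
/-- Amalgamation for finite systems with a permutation: two equivariant surjections
`f : (X, τ) → (W, σ)` and `g : (Y, π) → (W, σ)` of finite nonempty systems can be
amalgamated over a finite nonempty system `(Z, ρ)`. -/
theorem amalgamation_finite_perm (W X Y : Type)
    [Finite W] [Nonempty W] [Finite X] [Nonempty X] [Finite Y] [Nonempty Y]
    (σ : Equiv.Perm W) (τ : Equiv.Perm X) (π : Equiv.Perm Y)
    (f : X → W) (g : Y → W) (hf : Function.Surjective f) (hg : Function.Surjective g)
    (hfe : f ∘ τ = σ ∘ f) (hge : g ∘ π = σ ∘ g) :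
    ∃ (Z : Type) (_ : Finite Z) (_ : Nonempty Z) (ρ : Equiv.Perm Z)
      (h : Z → X) (i : Z → Y),
      Function.Surjective h ∧ Function.Surjective i ∧
        h ∘ ρ = τ ∘ h ∧ i ∘ ρ = π ∘ i ∧ f ∘ h = g ∘ i := by
  have hf' : ∀ x, f (τ x) = σ (f x) := congrFun hfe
  have hg' : ∀ y, g (π y) = σ (g y) := congrFun hge
  have lift_fst : ∀ x, ∃ z : {p : X × Y // f p.1 = g p.2}, z.1.1 = x := fun x ↦
    let ⟨y, hy⟩ := hg (f x)
    ⟨⟨(x, y), hy.symm⟩, rfl⟩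
  have lift_snd : ∀ y, ∃ z : {p : X × Y // f p.1 = g p.2}, z.1.2 = y := fun y ↦
    let ⟨x, hx⟩ := hf (g y)
    ⟨⟨(x, y), hx⟩, rfl⟩
  refine ⟨{p : X × Y // f p.1 = g p.2}, inferInstance,
    (lift_fst (Classical.arbitrary X)).nonempty,
    (Equiv.prodCongr τ π).subtypeEquiv fun p ↦ ?_,
    fun z ↦ z.1.1, fun z ↦ z.1.2, lift_fst, lift_snd, rfl, rfl, funext fun z ↦ z.2⟩
  simp [hf', hg']
end
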